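/- Assume the setup with deg h = t, and suppose deg[F,G] < d + i for some i ∈ {1,…,N}. Then there exist constants a_i, a_{i+1}, …, a_{N−1} ∈ ℂ such that for every j with i ≤ j ≤ N, the identity G_j = Σ_{α ∈ Z^{(t)}_{j,N,d}} c^{(j)}_α·F₁^{α₁}⋯F_s^{α_s}·h^{α₀} holds in the localization ℂ[x₁,…,xₙ][1/h], where with r = d/t one has c^{(j)}_α = (∏_{k=1}^{α₁+⋯+α_s}(α₀+r·k)) / ((∏_{i₁=1}^{α₁} r·i₁)·(∏_{i₂=1}^{α₂} r·i₂)⋯(∏_{i_s=1}^{α_s} r·i_s)) · a_{tα₀+d(α₁+⋯+α_s)}, with a_N the constant from the setup. Moreover, a_j = 0 whenever t does not divide j. -/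

import Mathlib

open MvPolynomial

noncomputable section

/-- A nonconstant homogeneous polynomial `h` is *not a proper power* if it cannot be
written as `b • g ^ k` with `g` homogeneous of degree strictly smaller than `deg h`
and `k ≥ 2`. -/
def NotProperPower {n : ℕ} (h : MvPolynomial (Fin n) ℂ) : Prop :=
  ¬ ∃ (b : ℂ) (g : MvPolynomial (Fin n) ℂ) (k m : ℕ),
      2 ≤ k ∧ g.IsHomogeneous m ∧ m < h.totalDegree ∧ h = b • g ^ k

/-- `deg [f,g] < B`, where `deg [f,g] = 2 + max` of the total degrees of the Jacobian
minors (with the convention `deg 0 = -∞`). -/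
def PoissonDegLT {n : ℕ} (f g : MvPolynomial (Fin n) ℂ) (B : ℤ) : Prop :=
  ∀ p q : Fin n,
    pderiv p f * pderiv q g - pderiv q f * pderiv p g = 0 ∨
    ((pderiv p f * pderiv q g - pderiv q f * pderiv p g).totalDegree : ℤ) + 2 < B

/-- The set `Z^{(t)}_{j,N,d}` of multi-indices `(α₀,α₁,…,α_s) ∈ ℤ × ℕ^s` (here `s = d-1`,
and `α.2 l` represents `α_{l+1}`) with `tα₀ + α₁ + 2α₂ + ⋯ + sα_s = j` and
`tα₀ + d(α₁ + ⋯ + α_s) ≤ N`. -/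
def ZsetT (s : ℕ) (j N d t : ℤ) : Set (ℤ × (Fin s → ℕ)) :=
  {α | t * α.1 + ∑ l : Fin s, ((l : ℤ) + 1) * (α.2 l : ℤ) = j ∧
       t * α.1 + d * ∑ l : Fin s, (α.2 l : ℤ) ≤ N}

/-- The image of `h` in the localization `ℂ[x₁,…,xₙ][1/h]`, as a unit. -/
def hUnit {n : ℕ} (h : MvPolynomial (Fin n) ℂ) : (Localization.Away h)ˣ :=
  (IsLocalization.Away.algebraMap_isUnit (S := Localization.Away h) h).unit

/-- The monomial `F₁^{α₁} ⋯ F_s^{α_s} · h^{α₀}` (with `α₀ ∈ ℤ`) in `ℂ[x₁,…,xₙ][1/h]`,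
where `Fl l` is the homogeneous component of `F` of degree `l+1`. -/
def monom {n : ℕ} (h : MvPolynomial (Fin n) ℂ) (s : ℕ)
    (Fl : Fin s → MvPolynomial (Fin n) ℂ) (α : ℤ × (Fin s → ℕ)) :
    Localization.Away h :=
  (∏ l : Fin s, algebraMap (MvPolynomial (Fin n) ℂ) (Localization.Away h) (Fl l) ^ α.2 l) *
    ((hUnit h ^ α.1 : (Localization.Away h)ˣ) : Localization.Away h)

set_option linter.unusedSectionVars false

lemma aux_coeff_euler {n : ℕ} (f : MvPolynomial (Fin n) ℂ) (m : Fin n →₀ ℕ) :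
    coeff m (∑ p, X p * pderiv p f) = (m.degree : ℂ) * coeff m f := by
  induction f using MvPolynomial.induction_on' with
  | monomial u a =>
    have : ∑ p, X p * pderiv p (monomial u a) = (u.degree : ℂ) • monomial u a := by
      simp only [X_mul_pderiv_monomial]
      rw [← Finset.sum_smul, Finsupp.degree_eq_sum]
      rw [← Nat.cast_smul_eq_nsmul ℂ]
    rw [this, coeff_smul, coeff_monomial]
    split_ifs with h
    · simp [h]
    · simp
  | add p q hp hq =>
    simp only [map_add, mul_add, Finset.sum_add_distrib, coeff_add, hp, hq]

lemma aux_homog_of_euler {n : ℕ} (f : MvPolynomial (Fin n) ℂ) (k : ℕ)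
    (hf : ∑ p, X p * pderiv p f = (k : ℂ) • f) : f.IsHomogeneous k := by
  intro m hm
  have := aux_coeff_euler f m
  rw [hf, coeff_smul, smul_eq_mul] at this
  have h2 := mul_right_cancel₀ hm this
  have h3 : k = m.degree := by exact_mod_cast h2
  rw [h3, Finsupp.degree_eq_weight_one]; rfl

lemma aux_pderiv_zero {n : ℕ} (B : MvPolynomial (Fin n) ℂ) (p : Fin n)
    (h : B ∣ pderiv p B) : pderiv p B = 0 := by
  by_contra h0
  obtain ⟨c, hc⟩ := h
  have hc0 : c ≠ 0 := by rintro rfl; simp [hc] at h0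
  have hB0 : B ≠ 0 := by rintro rfl; simp at h0
  have h1 := degreeOf_mul_eq (n := p) hB0 hc0
  rw [← hc] at h1
  -- degree of pderiv smaller
  have hdpos : 0 < degreeOf p (pderiv p B) + 1 := by omega
  obtain ⟨m, hm, hme⟩ : ∃ m ∈ (pderiv p B).support, m p = degreeOf p (pderiv p B) := by
    rw [degreeOf_eq_sup]
    obtain ⟨m, hm, hh⟩ := Finset.exists_mem_eq_sup (pderiv p B).support
      (by simpa using h0) (fun m => m p)
    exact ⟨m, hm, hh.symm⟩
  rw [mem_support_iff, coeff_pderiv] at hm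
  have hm2 : m + Finsupp.single p 1 ∈ B.support := by
    rw [mem_support_iff]; intro h; simp [h] at hm
  have := degreeOf_le_iff.mp (le_refl (degreeOf p B)) _ hm2
  simp at this
  omega

lemma aux_const {n : ℕ} (B : MvPolynomial (Fin n) ℂ) (h : ∀ p, pderiv p B = 0) :
    ∃ c, B = C c := by
  have : B.IsHomogeneous 0 := aux_homog_of_euler B 0 (by simp [h])
  exact ⟨_, totalDegree_eq_zero_iff_eq_C.mp (Nat.le_zero.mp this.totalDegree_le)⟩

lemma aux_prop {n : ℕ} (A B : MvPolynomial (Fin n) ℂ) (hB : B ≠ 0)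
    (h : ∀ p, A * pderiv p B = B * pderiv p A) : ∃ c : ℂ, A = C c * B := by
  obtain ⟨A', B', g, hrel, hA, hB2⟩ :=
    UniqueFactorizationMonoid.exists_reduced_factors' A B hB
  have hg : g ≠ 0 := by rintro rfl; simp at hB2; exact hB hB2.symm
  have hB' : B' ≠ 0 := by rintro rfl; simp at hB2; exact hB hB2.symm
  have key : ∀ p, A' * pderiv p B' = B' * pderiv p A' := by
    intro p
    have := h p
    rw [← hA, ← hB2] at this
    simp only [pderiv_mul] at this
    apply mul_left_cancel₀ (mul_ne_zero hg hg)
    linear_combination this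
  have hb : ∀ p, pderiv p B' = 0 := fun p =>
    aux_pderiv_zero _ _ (hrel.symm.dvd_of_dvd_mul_left ⟨_, key p⟩)
  have ha : ∀ p, pderiv p A' = 0 := fun p => by
    have := key p
    rw [hb] at this
    simpa [hB'] using this.symm
  obtain ⟨a, rfl⟩ := aux_const A' ha
  obtain ⟨b, rfl⟩ := aux_const B' hb
  have hb0 : b ≠ 0 := by rintro rfl; simp at hB'
  refine ⟨a / b, ?_⟩
  rw [← hA, ← hB2]
  have : (C a : MvPolynomial (Fin n) ℂ) = C (a/b) * C b := by
    rw [← C_mul]; congr 1; field_simp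
  rw [this]; ring

lemma aux_root {K : Type*} [Field K] [Algebra ℂ K] (x : K) (g : ℕ) (hg : 0 < g) (c : ℂ)
    (h : x ^ g = algebraMap ℂ K c) : ∃ c' : ℂ, x = algebraMap ℂ K c' := by
  have hint : IsIntegral ℂ x := by
    apply IsIntegral.of_pow hg
    rw [h]; exact isIntegral_algebraMap
  obtain ⟨y, hy⟩ := minpoly.mem_range_of_degree_eq_one ℂ x
    (IsAlgClosed.degree_eq_one_of_irreducible ℂ (minpoly.irreducible hint))
  exact ⟨y, hy.symm⟩

lemma aux_power {n : ℕ} (h Q : MvPolynomial (Fin n) ℂ) (t D : ℕ) (ht : 1 ≤ t)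
    (hh : h.IsHomogeneous t) (h0 : h ≠ 0) (hnp : NotProperPower h) (hQ0 : Q ≠ 0) (c : ℂ)
    (hQ : Q ^ t = C c * h ^ D) :
    t ∣ D ∧ ∃ c' : ℂ, Q = C c' * h ^ (D / t) := by
  let K := FractionRing (MvPolynomial (Fin n) ℂ)
  let φ := algebraMap (MvPolynomial (Fin n) ℂ) K
  have φinj : Function.Injective φ := IsFractionRing.injective _ _
  have φC : ∀ a : ℂ, φ (C a) = algebraMap ℂ K a := fun a => by
    rw [IsScalarTower.algebraMap_apply ℂ (MvPolynomial (Fin n) ℂ) K]; rfl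
  have hc0 : c ≠ 0 := by
    rintro rfl
    simp at hQ
    exact hQ0 hQ.1
  have hφh : φ h ≠ 0 := by simpa using (map_ne_zero_iff φ φinj).mpr h0
  have hφQ : φ Q ≠ 0 := (map_ne_zero_iff φ φinj).mpr hQ0
  have hQK : φ Q ^ t = algebraMap ℂ K c * φ h ^ D := by
    rw [← map_pow, hQ, map_mul, φC, map_pow]
  obtain ⟨t', ht'⟩ := Nat.gcd_dvd_left t D
  set g := Nat.gcd t D with hg
  have hgpos : 0 < g := Nat.gcd_pos_of_pos_left _ ht
  have bez := Nat.gcd_eq_gcd_ab t D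
  set u := Nat.gcdA t D
  set v := Nat.gcdB t D
  rw [← hg] at bez
  set y : K := φ Q ^ v * φ h ^ u with hy
  have hyt : y ^ t = algebraMap ℂ K (c ^ v) * φ h ^ g := by
    have e1 : y ^ t = (φ Q ^ t) ^ v * φ h ^ ((t:ℤ) * u) := by
      rw [hy, mul_pow, ← zpow_natCast, ← zpow_natCast, ← zpow_natCast, ← zpow_mul, ← zpow_mul,
        ← zpow_mul, mul_comm v, mul_comm u]
    rw [e1, hQK, mul_zpow, map_zpow₀, mul_assoc, ← zpow_natCast, ← zpow_natCast, ← zpow_mul,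
      ← zpow_add₀ hφh, bez]
    congr 2; ring
  obtain ⟨z, hz⟩ : ∃ z : ℂ, y ^ t' / φ h = algebraMap ℂ K z := by
    apply aux_root _ g hgpos (c ^ v)
    rw [div_pow, ← pow_mul, mul_comm t', ← ht', hyt, mul_div_cancel_right₀ _ (pow_ne_zero _ hφh)]
  have hyt' : y ^ t' = φ (C z * h) := by
    rw [map_mul, φC, ← hz, div_mul_cancel₀ _ hφh]
  have ht'pos : 0 < t' := by
    rcases Nat.eq_zero_or_pos t' with h | h
    · subst h; omega
    · exact h
  have hy0 : y ≠ 0 := mul_ne_zero (zpow_ne_zero _ hφQ) (zpow_ne_zero _ hφh)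
  have hz0 : z ≠ 0 := by
    rintro rfl
    simp at hyt'
    exact hy0 hyt'.1
  obtain ⟨y0, hy0'⟩ := IsIntegrallyClosed.exists_algebraMap_eq_of_isIntegral_pow
    (R := MvPolynomial (Fin n) ℂ) (K := K) (x := y) ht'pos
    (by rw [hyt']; exact isIntegral_algebraMap)
  have hy0t : y0 ^ t' = C z * h := by
    apply φinj
    rw [map_pow, ← hyt', ← hy0']
  have hy00 : y0 ≠ 0 := by rintro rfl; simp at hy0'; exact hy0 hy0'.symm
  have hhom : y0.IsHomogeneous g := by
    apply aux_homog_of_euler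
    have e := hh.sum_X_mul_pderiv
    have e2 : ∑ p, X p * pderiv p (y0 ^ t') = t • y0 ^ t' := by
      rw [hy0t]
      simp only [pderiv_C_mul]
      rw [mul_comm (C z) h, ← smul_mul_assoc, ← e, Finset.sum_mul]
      apply Finset.sum_congr rfl; intros; ring
    have e3 : ∑ p, X p * pderiv p (y0 ^ t') =
        (t' : MvPolynomial (Fin n) ℂ) * y0 ^ (t' - 1) * ∑ p, X p * pderiv p y0 := by
      rw [Finset.mul_sum]
      apply Finset.sum_congr rfl
      intros
      rw [pderiv_pow]; ring
    rw [e3] at e2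
    have hne : (t' : MvPolynomial (Fin n) ℂ) * y0 ^ (t' - 1) ≠ 0 :=
      mul_ne_zero (by exact_mod_cast ht'pos.ne') (pow_ne_zero _ hy00)
    apply mul_left_cancel₀ hne
    rw [e2]
    obtain ⟨w, rfl⟩ : ∃ w, t' = w + 1 := ⟨t' - 1, by omega⟩
    rw [ht', Nat.cast_smul_eq_nsmul ℂ]
    simp only [nsmul_eq_mul, Nat.add_sub_cancel]
    push_cast
    ring
  have ht1 : t' = 1 := by
    by_contra hne
    apply hnp
    refine ⟨z⁻¹, y0, t', g, by omega, hhom, ?_, ?_⟩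
    · rw [hh.totalDegree h0, ht']
      have : 2 ≤ t' := by omega
      nlinarith
    · rw [hy0t, smul_eq_C_mul, ← mul_assoc, ← C_mul, inv_mul_cancel₀ hz0]; simp
  have hgt : g = t := by rw [ht', ht1, mul_one]
  have hdvd : t ∣ D := by rw [← hgt]; exact Nat.gcd_dvd_right t D
  refine ⟨hdvd, ?_⟩
  obtain ⟨D', rfl⟩ := hdvd
  rw [Nat.mul_div_cancel_left _ (by omega)]
  obtain ⟨c', hc'⟩ := aux_root (φ Q / φ h ^ D') t (by omega) c (by
    rw [div_pow, hQK, ← pow_mul, mul_comm D', mul_div_cancel_right₀ _ (pow_ne_zero _ hφh)])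
  refine ⟨c', φinj ?_⟩
  rw [map_mul, φC, ← hc', map_pow, div_mul_cancel₀ _ (pow_ne_zero _ hφh)]

lemma aux_ext {R A : Type*} [CommRing R] [CommRing A] [Algebra ℂ R] [Algebra ℂ A] [Algebra R A]
    [IsScalarTower ℂ R A] (h : R) [IsLocalization.Away h A] (d : Derivation ℂ R R) :
    ∃ D : Derivation ℂ A A, ∀ f, D (algebraMap R A f) = algebraMap R A (d f) := by
  have := Algebra.FormallyEtale.of_isLocalization (Rₘ := A) (Submonoid.powers h)
  let d' : Derivation ℂ R A := (Algebra.linearMap R A).compDer d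
  let ℓ : KaehlerDifferential ℂ A →ₗ[A] A :=
    (LinearMap.liftBaseChange A d'.liftKaehlerDifferential) ∘ₗ
      (KaehlerDifferential.tensorKaehlerEquivOfFormallyEtale ℂ R A).symm.toLinearMap
  refine ⟨ℓ.compDer (KaehlerDifferential.D ℂ A), fun f => ?_⟩
  have := KaehlerDifferential.tensorKaehlerEquivOfFormallyEtale_symm_D_algebraMap ℂ R A f
  simp [ℓ, this, d']

section
open Polynomial

def pdFun {A : Type*} [CommRing A] [Algebra ℂ A] (D : Derivation ℂ A A) (f : Polynomial A) :
    Polynomial A := ∑ m ∈ f.support, Polynomial.monomial m (D (f.coeff m))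

lemma coeff_pdFun {A : Type*} [CommRing A] [Algebra ℂ A] (D : Derivation ℂ A A)
    (f : Polynomial A) (m : ℕ) : (pdFun D f).coeff m = D (f.coeff m) := by
  simp only [pdFun, Polynomial.finsetSum_coeff, Polynomial.coeff_monomial, Finset.sum_ite_eq',
    Polynomial.mem_support_iff]
  split_ifs with h
  · rfl
  · rw [Polynomial.notMem_support_iff.mp h, map_zero]

def pd {A : Type*} [CommRing A] [Algebra ℂ A] (D : Derivation ℂ A A) :
    Derivation ℂ (Polynomial A) (Polynomial A) :=
  Derivation.mk'
    { toFun := pdFun D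
      map_add' := by
        intro f g
        ext m
        simp [coeff_pdFun]
      map_smul' := by
        intro c f
        ext m
        simp [coeff_pdFun] }
    (by
      intro f g
      ext m
      simp only [LinearMap.coe_mk, AddHom.coe_mk, coeff_pdFun, Polynomial.coeff_add, smul_eq_mul,
        Polynomial.coeff_mul, map_sum, Derivation.leibniz, Finset.sum_add_distrib]
      congr 1
      rw [← Finset.Nat.sum_antidiagonal_swap]
      rfl)

lemma coeff_pd {A : Type*} [CommRing A] [Algebra ℂ A] (D : Derivation ℂ A A) (f : Polynomial A)
    (m : ℕ) : (pd D f).coeff m = D (f.coeff m) := coeff_pdFun D f m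

/-- Binomial-type coefficients. -/
def bc (q r k : ℕ) : ℂ := ∏ m ∈ Finset.range k, (((q : ℂ) - r * m) / (r * (m + 1)))

/-- Truncated binomial series. -/
def bs (q r K : ℕ) : Polynomial ℂ := ∑ k ∈ Finset.range (K + 1), Polynomial.C (bc q r k) * Polynomial.X ^ k

lemma bc_succ (q r k : ℕ) (hr : 1 ≤ r) :
    (r : ℂ) * (k + 1) * bc q r (k + 1) = (q - r * k) * bc q r k := by
  rw [bc, Finset.prod_range_succ, ← bc]
  have h1 : (r : ℂ) ≠ 0 := by exact_mod_cast (by omega : r ≠ 0)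
  have h2 : (k : ℂ) + 1 ≠ 0 := by exact_mod_cast Nat.succ_ne_zero k
  field_simp

lemma bs_ode (q r K : ℕ) (hr : 1 ≤ r) :
    (r : Polynomial ℂ) * (1 + Polynomial.X) * derivative (bs q r K) - (q : Polynomial ℂ) * bs q r K
      = Polynomial.C (((r : ℂ) * K - q) * bc q r K) * Polynomial.X ^ K := by
  induction K with
  | zero => simp [bs, bc]
  | succ K ih =>
    have e : bs q r (K + 1) = bs q r K + Polynomial.C (bc q r (K+1)) * Polynomial.X ^ (K+1) := by
      rw [bs, Finset.sum_range_succ]; rfl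
    have hs := congrArg (Polynomial.C) (bc_succ q r K hr)
    simp only [map_mul, map_add, map_sub, map_natCast, map_one] at hs
    rw [e, derivative_add, derivative_C_mul, derivative_X_pow]
    simp only [map_mul, map_add, map_sub, map_natCast, map_one, Nat.cast_add, Nat.cast_one, Nat.add_sub_cancel] at ih ⊢
    linear_combination ih + hs * Polynomial.X ^ K

lemma aux_series {B : Type*} [CommRing B] [Algebra ℂ B] (D1 D2 : Derivation ℂ B B) (H U : B)
    (hH : IsUnit H) (q r K : ℕ) (hr : 1 ≤ r) :
    U ^ K ∣ D1 (H ^ r * (1 + U)) * D2 (H ^ q * Polynomial.aeval U (bs q r K))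
      - D2 (H ^ r * (1 + U)) * D1 (H ^ q * Polynomial.aeval U (bs q r K)) := by
  rw [← hH.dvd_mul_left]
  have hp : ∀ (D : Derivation ℂ B B) (k : ℕ), H * D (H ^ k) = k * H ^ k * D H := by
    intro D k
    rw [Derivation.leibniz_pow]
    rcases k with _ | k
    · simp
    · simp [pow_succ]; ring
  have ode := congrArg (Polynomial.aeval U) (bs_ode q r K hr)
  simp only [map_sub, map_mul, map_add, map_natCast, map_one, Polynomial.aeval_X, map_pow, Polynomial.aeval_C] at ode
  set S := Polynomial.aeval U (bs q r K)
  have hS : ∀ D : Derivation ℂ B B, D S = Polynomial.aeval U (derivative (bs q r K)) * D U := by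
    intro D; rw [Derivation.map_aeval, smul_eq_mul]
  set S' := Polynomial.aeval U (derivative (bs q r K))
  refine ⟨H ^ r * H ^ q * (D1 H * D2 U - D2 H * D1 U) *
    ((algebraMap ℂ B) r * algebraMap ℂ B K - algebraMap ℂ B q) * algebraMap ℂ B (bc q r K), ?_⟩
  have e1 : ∀ D : Derivation ℂ B B, H * D (H ^ r * (1 + U)) =
      H ^ r * (r * (1 + U) * D H + H * D U) := by
    intro D
    simp only [Derivation.leibniz, smul_eq_mul, map_add, Derivation.map_one_eq_zero, zero_add]
    linear_combination (1 + U) * hp D r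
  have e2 : ∀ D : Derivation ℂ B B, H * D (H ^ q * S) =
      H ^ q * (q * S * D H + H * (S' * D U)) := by
    intro D
    simp only [Derivation.leibniz, smul_eq_mul, hS]
    linear_combination S * hp D q
  simp only [map_natCast] at ode ⊢
  apply hH.mul_left_cancel
  have : H * (H * (D1 (H ^ r * (1 + U)) * D2 (H ^ q * S) - D2 (H ^ r * (1 + U)) * D1 (H ^ q * S)))
    = (H * D1 (H ^ r * (1 + U))) * (H * D2 (H ^ q * S)) -
      (H * D2 (H ^ r * (1 + U))) * (H * D1 (H ^ q * S)) := by ring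
  rw [this, e1, e1, e2, e2]
  linear_combination H ^ r * H ^ q * H * (D1 H * D2 U - D2 H * D1 U) * ode
end

section step
variable {n : ℕ} {A : Type*} [CommRing A] [Algebra ℂ A] [Algebra (MvPolynomial (Fin n) ℂ) A]
  [IsScalarTower ℂ (MvPolynomial (Fin n) ℂ) A]

lemma aux_step (h : MvPolynomial (Fin n) ℂ) [IsLocalization.Away h A]
    (D : Fin n → Derivation ℂ A A)
    (hD : ∀ (p : Fin n) (f : MvPolynomial (Fin n) ℂ), D p (algebraMap _ A f) = algebraMap _ A (pderiv p f))
    (t j : ℕ) (ht : 1 ≤ t) (hj : 1 ≤ j) (hh : h.IsHomogeneous t) (h0 : h ≠ 0)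
    (hnp : NotProperPower h) (P : A)
    (hE : ∑ p, algebraMap (MvPolynomial (Fin n) ℂ) A (X p) * D p P = (j : A) * P)
    (hbr : ∀ p q, D p (algebraMap _ A h) * D q P = D q (algebraMap _ A h) * D p P) :
    (t ∣ j ∧ ∃ c : ℂ, P = c • (algebraMap _ A h) ^ (j / t)) ∨ P = 0 := by
  set φ := algebraMap (MvPolynomial (Fin n) ℂ) A with hφ
  have hu : IsUnit (φ h) := IsLocalization.Away.algebraMap_isUnit h
  have φinj : Function.Injective φ := IsLocalization.injective A
    (M := Submonoid.powers h) (powers_le_nonZeroDivisors_of_noZeroDivisors h0)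
  obtain ⟨M, Q, hQ⟩ := IsLocalization.Away.surj h P
  rw [← hφ] at hQ
  have hDQ : ∀ p, φ (pderiv p Q) = D p P * φ h ^ M + P * (M * φ h ^ (M - 1) * φ (pderiv p h)) := by
    intro p
    rw [← hD, ← hQ, Derivation.leibniz, Derivation.leibniz_pow, hD]
    simp only [smul_eq_mul, nsmul_eq_mul]
    ring
  have hM : (M : A) * φ h ^ (M - 1) * φ h = M * φ h ^ M := by
    rcases M with _ | M
    · simp
    · simp [pow_succ, mul_assoc]
  have hQhom : Q.IsHomogeneous (j + t * M) := by
    apply aux_homog_of_euler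
    apply φinj
    have e := congrArg φ hh.sum_X_mul_pderiv
    rw [Nat.cast_smul_eq_nsmul ℂ, nsmul_eq_mul, map_mul, map_natCast, ← hQ]
    simp only [map_sum, map_mul, hDQ, nsmul_eq_mul, map_natCast] at e ⊢
    have : ∀ p, φ (X p) * (D p P * φ h ^ M + P * (M * φ h ^ (M - 1) * φ (pderiv p h))) =
      (φ (X p) * D p P) * φ h ^ M + (φ (X p) * φ (pderiv p h)) * (P * (M * φ h ^ (M - 1))) := by
      intro p; ring
    simp only [this, Finset.sum_add_distrib, ← Finset.sum_mul, hE, e]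
    push_cast
    linear_combination (t : A) * P * hM
  have hbrQ : ∀ p q, pderiv p h * pderiv q Q = pderiv q h * pderiv p Q := by
    intro p q
    apply φinj
    have := hbr p q
    rw [hD, hD] at this
    rw [map_mul, map_mul, hDQ, hDQ]
    linear_combination φ h ^ M * this
  have hE2 : ∀ q, (t : MvPolynomial (Fin n) ℂ) * h * pderiv q Q =
      ((j + t * M : ℕ) : MvPolynomial (Fin n) ℂ) * Q * pderiv q h := by
    intro q
    rw [← nsmul_eq_mul, ← hh.sum_X_mul_pderiv, ← nsmul_eq_mul _ Q, ← hQhom.sum_X_mul_pderiv,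
      Finset.sum_mul, Finset.sum_mul]
    apply Finset.sum_congr rfl
    intro p _
    linear_combination X p * hbrQ p q
  by_cases hQ0 : Q = 0
  · right
    rw [hQ0, map_zero] at hQ
    exact ((hu.pow M).mul_left_eq_zero).mp hQ
  left
  set E := j + t * M with hEdef
  obtain ⟨c, hc⟩ := aux_prop (Q ^ t) (h ^ E) (pow_ne_zero _ h0) (by
    intro p
    rw [pderiv_pow, pderiv_pow]
    obtain ⟨t', rfl⟩ : ∃ t', t = t' + 1 := ⟨t - 1, by omega⟩
    obtain ⟨E', hE'⟩ : ∃ E', E = E' + 1 := ⟨E - 1, by omega⟩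
    have := hE2 p
    rw [hE'] at this ⊢
    simp only [Nat.add_sub_cancel]
    linear_combination (- Q ^ t' * h ^ E') * this)
  obtain ⟨hdvd, c', hc'⟩ := aux_power h Q t E ht hh h0 hnp hQ0 c hc
  have htj : t ∣ j := by
    rw [hEdef] at hdvd
    exact (Nat.dvd_add_left (dvd_mul_right t M)).mp hdvd
  refine ⟨htj, c', ?_⟩
  have : E / t = j / t + M := by
    rw [hEdef, Nat.add_mul_div_left _ _ (by omega)]
  apply (hu.pow M).mul_right_cancel
  rw [hQ, hc', this, ← smul_eq_C_mul, Algebra.smul_def, Algebra.smul_def, map_mul, map_pow, pow_add,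
    IsScalarTower.algebraMap_apply ℂ (MvPolynomial (Fin n) ℂ) A]
  ring
end step

section lamsec
variable {n : ℕ} {A : Type*} [CommRing A] [Algebra ℂ A] [Algebra (MvPolynomial (Fin n) ℂ) A]
  [IsScalarTower ℂ (MvPolynomial (Fin n) ℂ) A]

variable (A) in
/-- The grading homomorphism `x_p ↦ x_p T`. -/
def lam : MvPolynomial (Fin n) ℂ →ₐ[ℂ] Polynomial A :=
  MvPolynomial.aeval (fun p => Polynomial.C (algebraMap (MvPolynomial (Fin n) ℂ) A (X p)) * Polynomial.X)

lemma lam_monomial (u : Fin n →₀ ℕ) (a : ℂ) : lam A (monomial u a) =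
    Polynomial.C (algebraMap (MvPolynomial (Fin n) ℂ) A (monomial u a)) * Polynomial.X ^ u.degree := by
  rw [lam, MvPolynomial.aeval_monomial, MvPolynomial.monomial_eq, map_mul, map_mul]
  rw [Finsupp.prod_fintype _ _ (by simp), Finsupp.prod_fintype _ _ (by simp), Finsupp.degree_eq_sum]
  simp only [mul_pow, Finset.prod_mul_distrib, map_prod, map_pow, Finset.prod_pow_eq_pow_sum]
  rw [Polynomial.algebraMap_apply, IsScalarTower.algebraMap_apply ℂ (MvPolynomial (Fin n) ℂ) A,
    MvPolynomial.algebraMap_eq]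
  ring

lemma coeff_lam (f : MvPolynomial (Fin n) ℂ) (m : ℕ) :
    (lam A f).coeff m = algebraMap (MvPolynomial (Fin n) ℂ) A (homogeneousComponent m f) := by
  induction f using MvPolynomial.induction_on' with
  | monomial u a =>
    rw [lam_monomial, Polynomial.coeff_C_mul_X_pow,
      homogeneousComponent_of_mem (isHomogeneous_monomial a rfl)]
    split_ifs <;> simp
  | add p q hp hq => simp only [map_add, Polynomial.coeff_add, hp, hq]

lemma natDegree_lam (f : MvPolynomial (Fin n) ℂ) : (lam A f).natDegree ≤ f.totalDegree := by
  rw [Polynomial.natDegree_le_iff_coeff_eq_zero]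
  intro m hm
  rw [coeff_lam, homogeneousComponent_eq_zero _ _ hm, map_zero]

lemma pd_X_pow (D : Derivation ℂ A A) (k : ℕ) : pd D (Polynomial.X ^ k) = 0 := by
  ext m
  rw [coeff_pd, Polynomial.coeff_X_pow]
  split_ifs <;> simp

lemma pd_C (D : Derivation ℂ A A) (a : A) : pd D (Polynomial.C a) = Polynomial.C (D a) := by
  ext m
  rw [coeff_pd, Polynomial.coeff_C, Polynomial.coeff_C]
  split_ifs <;> simp

variable (D : Fin n → Derivation ℂ A A)

lemma pd_lam
    (hD : ∀ (p : Fin n) (f : MvPolynomial (Fin n) ℂ), D p (algebraMap _ A f) = algebraMap _ A (pderiv p f))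
    (p : Fin n) (f : MvPolynomial (Fin n) ℂ) :
    pd (D p) (lam A f) = Polynomial.X * lam A (pderiv p f) := by
  induction f using MvPolynomial.induction_on with
  | C a =>
    rw [pderiv_C, map_zero, mul_zero, ← MvPolynomial.algebraMap_eq, AlgHom.commutes,
      Derivation.map_algebraMap]
  | add f g hf hg => simp only [map_add, hf, hg, mul_add]
  | mul_X f j hf =>
    have hX : lam A (X j : MvPolynomial (Fin n) ℂ) =
      Polynomial.C (algebraMap (MvPolynomial (Fin n) ℂ) A (X j)) * Polynomial.X := by simp [lam]
    have h1 := pd_X_pow (D p) 1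
    rw [pow_one] at h1
    have hX' : pd (D p) (lam A (X j : MvPolynomial (Fin n) ℂ)) =
        Polynomial.X * lam A (pderiv p (X j : MvPolynomial (Fin n) ℂ)) := by
      rw [hX, Derivation.leibniz, h1, pd_C, hD, pderiv_X]
      by_cases hjp : p = j
      · subst hjp; simp
      · simp [Ne.symm hjp]
    rw [map_mul, Derivation.leibniz, pderiv_mul, map_add, map_mul, map_mul, hf, hX', smul_eq_mul,
      smul_eq_mul]
    ring

lemma pd_reflect (D : Derivation ℂ A A) (N : ℕ) (f : Polynomial A) :
    pd D (Polynomial.reflect N f) = Polynomial.reflect N (pd D f) := by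
  ext m
  simp only [coeff_pd, Polynomial.coeff_reflect]

lemma natDegree_pd (D : Derivation ℂ A A) (f : Polynomial A) : (pd D f).natDegree ≤ f.natDegree := by
  rw [Polynomial.natDegree_le_iff_coeff_eq_zero]
  intro m hm
  rw [coeff_pd, Polynomial.coeff_eq_zero_of_natDegree_lt hm, map_zero]

lemma bracket_reflect
    (hD : ∀ (p : Fin n) (f : MvPolynomial (Fin n) ℂ), D p (algebraMap _ A f) = algebraMap _ A (pderiv p f))
    (F G : MvPolynomial (Fin n) ℂ) (d N i : ℕ)
    (hF : F.totalDegree = d) (hG : G.totalDegree = N) (hiN : i ≤ N)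
    (p q : Fin n)
    (hpq : pderiv p F * pderiv q G - pderiv q F * pderiv p G = 0 ∨
    ((pderiv p F * pderiv q G - pderiv q F * pderiv p G).totalDegree : ℤ) + 2 < (d : ℤ) + i) :
    Polynomial.X ^ (N - i + 1) ∣
      pd (D p) (Polynomial.reflect d (lam A F)) * pd (D q) (Polynomial.reflect N (lam A G)) -
      pd (D q) (Polynomial.reflect d (lam A F)) * pd (D p) (Polynomial.reflect N (lam A G)) := by
  have dF : ∀ p, (pd (D p) (lam A F)).natDegree ≤ d := fun p =>
    (natDegree_pd _ _).trans (hF ▸ natDegree_lam F)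
  have dG : ∀ p, (pd (D p) (lam A G)).natDegree ≤ N := fun p =>
    (natDegree_pd _ _).trans (hG ▸ natDegree_lam G)
  simp only [pd_reflect]
  rw [← Polynomial.reflect_mul _ _ (dF p) (dG q), ← Polynomial.reflect_mul _ _ (dF q) (dG p)]
  rw [Polynomial.X_pow_dvd_iff]
  intro m hm
  have key : pd (D p) (lam A F) * pd (D q) (lam A G) - pd (D q) (lam A F) * pd (D p) (lam A G) =
      Polynomial.X ^ 2 * lam A (pderiv p F * pderiv q G - pderiv q F * pderiv p G) := by
    simp only [pd_lam D hD, map_sub, map_mul]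
    ring
  rw [Polynomial.coeff_sub, Polynomial.coeff_reflect, Polynomial.coeff_reflect,
    ← Polynomial.coeff_sub, key, Polynomial.revAt_le (by omega)]
  rcases hpq with h0 | hlt
  · simp [h0]
  · obtain ⟨w, hw⟩ : ∃ w, d + N - m = w + 2 := ⟨d + N - m - 2, by omega⟩
    rw [hw, Polynomial.coeff_X_pow_mul, coeff_lam, homogeneousComponent_eq_zero _ _ (by omega),
      map_zero]

/-- The Euler derivation on `A`. -/
def eul : Derivation ℂ A A := ∑ p, (algebraMap (MvPolynomial (Fin n) ℂ) A (X p)) • D p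

lemma eul_apply (x : A) :
    eul D x = ∑ p, algebraMap (MvPolynomial (Fin n) ℂ) A (X p) * D p x := by
  have : ∀ s : Finset (Fin n), (∑ p ∈ s, (algebraMap (MvPolynomial (Fin n) ℂ) A (X p)) • D p) x =
      ∑ p ∈ s, algebraMap (MvPolynomial (Fin n) ℂ) A (X p) * D p x := by
    intro s
    induction s using Finset.induction_on with
    | empty => simp
    | insert a s ha ih =>
      rw [Finset.sum_insert ha, Finset.sum_insert ha, Derivation.add_apply, ih]; rfl
  exact this _

lemma eul_homog
    (hD : ∀ (p : Fin n) (f : MvPolynomial (Fin n) ℂ), D p (algebraMap _ A f) = algebraMap _ A (pderiv p f))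
    (f : MvPolynomial (Fin n) ℂ) (k : ℕ) (hf : f.IsHomogeneous k) :
    eul D (algebraMap _ A f) = (k : A) * algebraMap _ A f := by
  rw [eul_apply]
  have := congrArg (algebraMap (MvPolynomial (Fin n) ℂ) A) hf.sum_X_mul_pderiv
  simp only [hD]
  simpa [nsmul_eq_mul] using this

/-- The Euler derivation on `A[T]`. -/
def eulT : Derivation ℂ (Polynomial A) (Polynomial A) :=
  pd (eul D) + (Polynomial.X : Polynomial A) • (Polynomial.derivative' (R := A)).restrictScalars ℂ

lemma coeff_eulT (f : Polynomial A) (m : ℕ) :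
    (eulT D f).coeff m = eul D (f.coeff m) + m * f.coeff m := by
  have : eulT D f = pd (eul D) f + Polynomial.X * Polynomial.derivative f := rfl
  rw [this, Polynomial.coeff_add, coeff_pd]
  congr 1
  rcases m with _ | m
  · simp
  · rw [Polynomial.coeff_X_mul, Polynomial.coeff_derivative]; push_cast; ring

lemma eulT_X_pow (k : ℕ) : eulT D (Polynomial.X ^ k) = (k : Polynomial A) * Polynomial.X ^ k := by
  ext m
  rw [coeff_eulT, Polynomial.coeff_natCast_mul, Polynomial.coeff_X_pow]
  split_ifs with h <;> simp [h]

lemma eulT_reflect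
    (hD : ∀ (p : Fin n) (f : MvPolynomial (Fin n) ℂ), D p (algebraMap _ A f) = algebraMap _ A (pderiv p f))
    (F : MvPolynomial (Fin n) ℂ) (d : ℕ) (hF : F.totalDegree = d) :
    eulT D (Polynomial.reflect d (lam A F)) = (d : Polynomial A) * Polynomial.reflect d (lam A F) := by
  ext m
  rw [coeff_eulT, Polynomial.coeff_natCast_mul, Polynomial.coeff_reflect, coeff_lam]
  by_cases h : m ≤ d
  · rw [Polynomial.revAt_le h, eul_homog D hD _ (d - m) (homogeneousComponent_isHomogeneous _ _)]
    push_cast [h]; ring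
  · rw [Polynomial.revAt_eq_self_of_lt (by omega), homogeneousComponent_eq_zero _ _ (by omega)]
    simp

end lamsec

section mainind
variable {n : ℕ} {A : Type*} [CommRing A] [Algebra ℂ A] [Algebra (MvPolynomial (Fin n) ℂ) A]
  [IsScalarTower ℂ (MvPolynomial (Fin n) ℂ) A]

/-- The truncated expansion of `T^(N-tq) F^(q/r)`. -/
def Pq (H U : Polynomial A) (N t r q : ℕ) : Polynomial A :=
  Polynomial.X ^ (N - t * q) * (H ^ q * Polynomial.aeval U (bs q r N))

lemma coeff_zero_bs (U : Polynomial A) (hU : Polynomial.X ∣ U) (q r N : ℕ) :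
    (Polynomial.aeval U (bs q r N)).coeff 0 = 1 := by
  have hU0 : U.coeff 0 = 0 := Polynomial.X_dvd_iff.mp hU
  rw [bs, map_sum, Polynomial.finsetSum_coeff, Finset.sum_eq_single 0]
  · simp [bc]
  · intro k _ hk
    simp [Polynomial.coeff_zero_eq_eval_zero] at hU0 ⊢
    simp [hU0, hk]
  · simp

lemma main_ind (h : MvPolynomial (Fin n) ℂ) [IsLocalization.Away h A]
    (D : Fin n → Derivation ℂ A A)
    (hD : ∀ (p : Fin n) (f : MvPolynomial (Fin n) ℂ), D p (algebraMap _ A f) = algebraMap _ A (pderiv p f))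
    (t N r i : ℕ) (ht : 1 ≤ t) (hr : 1 ≤ r) (hi : 1 ≤ i) (hiN : i ≤ N) (htN : t ∣ N)
    (hh : h.IsHomogeneous t) (h0 : h ≠ 0) (hnp : NotProperPower h)
    (Ft Gt U H : Polynomial A) (hH : H = Polynomial.C (algebraMap _ A h))
    (hFt : Ft = H ^ r * (1 + U)) (hU : Polynomial.X ∣ U)
    (hEF : eulT D Ft = ((r * t : ℕ) : Polynomial A) * Ft)
    (hEG : eulT D Gt = (N : Polynomial A) * Gt)
    (aN : ℂ) (hG0 : Gt.coeff 0 = aN • (algebraMap _ A h) ^ (N / t))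
    (hbr : ∀ p q, Polynomial.X ^ (N - i + 1) ∣
      pd (D p) Ft * pd (D q) Gt - pd (D q) Ft * pd (D p) Gt)
    (K : ℕ) (hK : K ≤ N - i) :
    ∃ a : ℕ → ℂ, a (N / t) = aN ∧
      Polynomial.X ^ (K + 1) ∣ Gt - ∑ q ∈ Finset.range (N / t + 1), a q • Pq H U N t r q := by
  have hHu : IsUnit H := by
    rw [hH]; exact (IsLocalization.Away.algebraMap_isUnit h).map Polynomial.C
  -- Euler facts
  have hEH : eulT D H = (t : Polynomial A) * H := by
    rw [hH]
    ext m
    rw [coeff_eulT, Polynomial.coeff_natCast_mul, Polynomial.coeff_C]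
    split_ifs with hm
    · rw [eul_homog D hD h t hh]; simp [hm]
    · simp
  have hEHk : ∀ k : ℕ, eulT D (H ^ k) = ((k * t : ℕ) : Polynomial A) * H ^ k := by
    intro k
    rw [Derivation.leibniz_pow, hEH]
    rcases k with _ | k
    · simp
    · simp [pow_succ]; ring
  have hEU : eulT D U = 0 := by
    rw [hFt, Derivation.leibniz, hEHk, map_add, Derivation.map_one_eq_zero, zero_add, smul_eq_mul,
      smul_eq_mul] at hEF
    apply (hHu.pow r).mul_left_cancel
    linear_combination hEF
  have hEP : ∀ q ∈ Finset.range (N / t + 1), eulT D (Pq H U N t r q) = (N : Polynomial A) * Pq H U N t r q := by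
    intro q hq
    have hq' : q ≤ N / t := by simpa [Nat.lt_succ_iff] using hq
    have hqN : t * q ≤ N := by
      calc t * q ≤ t * (N / t) := Nat.mul_le_mul_left _ hq'
        _ ≤ N := Nat.mul_div_le N t
    rw [Pq, Derivation.leibniz, Derivation.leibniz, Derivation.map_aeval, hEU, eulT_X_pow, hEHk]
    simp only [smul_eq_mul, mul_zero, zero_add]
    push_cast [hqN]
    ring
  have hbrP : ∀ p q' q, Polynomial.X ^ (N - i + 1) ∣
      pd (D p) Ft * pd (D q') (Pq H U N t r q) - pd (D q') Ft * pd (D p) (Pq H U N t r q) := by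
    intro p q' q
    have h1 := aux_series (pd (D p)) (pd (D q')) H U hHu q r N hr
    rw [← hFt] at h1
    have h2 : Polynomial.X ^ (N - i + 1) ∣ U ^ N :=
      (pow_dvd_pow _ (by omega)).trans (pow_dvd_pow_of_dvd hU N)
    have h3 := (h2.trans h1).mul_left (Polynomial.X ^ (N - t * q))
    convert h3 using 1
    simp only [Pq, Derivation.leibniz _ (Polynomial.X ^ (N - t * q)), pd_X_pow, smul_eq_mul]
    ring
  have hF0 : Ft.coeff 0 = (algebraMap _ A h) ^ r := by
    have hU0 : U.coeff 0 = 0 := Polynomial.X_dvd_iff.mp hU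
    rw [hFt, Polynomial.mul_coeff_zero, Polynomial.coeff_add, hU0, hH, ← map_pow,
      Polynomial.coeff_C_zero]
    simp
  have hP0 : ∀ q, (H ^ q * Polynomial.aeval U (bs q r N)).coeff 0 = (algebraMap _ A h) ^ q := by
    intro q
    rw [Polynomial.mul_coeff_zero, coeff_zero_bs U hU, hH, ← map_pow, Polynomial.coeff_C_zero, mul_one]
  induction K with
  | zero =>
    refine ⟨fun q => if q = N / t then aN else 0, by simp, ?_⟩
    rw [zero_add, pow_one, Polynomial.X_dvd_iff]
    simp only [ite_smul, zero_smul, Finset.sum_ite_eq', Finset.mem_range, Nat.lt_succ_self, if_true]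
    rw [Polynomial.coeff_sub, hG0, Polynomial.coeff_smul, Pq, Nat.mul_div_cancel' htN,
      Nat.sub_self, pow_zero, one_mul, hP0, sub_self]
  | succ K ih =>
    obtain ⟨a, haN, ha⟩ := ih (by omega)
    set W := Gt - ∑ q ∈ Finset.range (N / t + 1), a q • Pq H U N t r q with hW
    have hEW : eulT D W = (N : Polynomial A) * W := by
      rw [hW, map_sub, hEG, map_sum, mul_sub, Finset.mul_sum]
      congr 1
      apply Finset.sum_congr rfl
      intro q hq
      rw [Derivation.map_smul, hEP q hq, mul_smul_comm]
    have hbrW : ∀ p q', Polynomial.X ^ (N - i + 1) ∣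
        pd (D p) Ft * pd (D q') W - pd (D q') Ft * pd (D p) W := by
      intro p q'
      have : pd (D p) Ft * pd (D q') W - pd (D q') Ft * pd (D p) W =
          (pd (D p) Ft * pd (D q') Gt - pd (D q') Ft * pd (D p) Gt) -
          ∑ q ∈ Finset.range (N / t + 1), a q • (pd (D p) Ft * pd (D q') (Pq H U N t r q)
            - pd (D q') Ft * pd (D p) (Pq H U N t r q)) := by
        rw [hW]
        simp only [map_sub, map_sum, Derivation.map_smul, smul_sub, Finset.sum_sub_distrib, mul_sub,
          Finset.mul_sum, mul_smul_comm]
        ring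
      rw [this]
      apply dvd_sub (hbr p q')
      apply Finset.dvd_sum
      intro q _
      rw [Algebra.smul_def]
      exact (hbrP p q' q).mul_left _
    obtain ⟨V, hV⟩ := ha
    set P := V.coeff 0 with hP
    have hWK : W.coeff (K + 1) = P := by
      rw [hV, hP]
      have := Polynomial.coeff_X_pow_mul V (K+1) 0
      simpa using this
    have hEP' : eul D P = ((N - (K + 1) : ℕ) : A) * P := by
      have := congrArg (fun f => Polynomial.coeff f (K + 1)) hEW
      simp only [coeff_eulT, Polynomial.coeff_natCast_mul, hWK] at this
      rw [Nat.cast_sub (by omega)]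
      linear_combination this
    have hbrP' : ∀ p q', D p (algebraMap _ A h) * D q' P = D q' (algebraMap _ A h) * D p P := by
      intro p q'
      have h1 := Polynomial.X_pow_dvd_iff.mp (hbrW p q') (K + 1) (by omega)
      have h2 : pd (D p) Ft * pd (D q') W - pd (D q') Ft * pd (D p) W =
        Polynomial.X ^ (K + 1) * (pd (D p) Ft * pd (D q') V - pd (D q') Ft * pd (D p) V) := by
        rw [hV]
        simp only [Derivation.leibniz _ (Polynomial.X ^ (K+1)), pd_X_pow, smul_eq_mul]
        ring
      rw [h2] at h1
      have h3 := Polynomial.coeff_X_pow_mul (pd (D p) Ft * pd (D q') V - pd (D q') Ft * pd (D p) V) (K+1) 0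
      rw [zero_add, h1] at h3
      rw [Polynomial.coeff_sub, Polynomial.mul_coeff_zero, Polynomial.mul_coeff_zero] at h3
      simp only [coeff_pd, hF0, ← hP, Derivation.leibniz_pow, nsmul_eq_mul, smul_eq_mul] at h3
      have hru : IsUnit (r : A) := by
        have : IsUnit ((r : ℂ)) := by
          rw [isUnit_iff_ne_zero]; exact_mod_cast (by omega : r ≠ 0)
        simpa using this.map (algebraMap ℂ A)
      have hu : IsUnit ((r : A) * algebraMap _ A h ^ (r - 1)) :=
        hru.mul ((IsLocalization.Away.algebraMap_isUnit h).pow _)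
      apply hu.mul_left_cancel
      linear_combination -h3
    have hcoef : ∀ m < K + 2, m ≠ K + 1 → W.coeff m = 0 := by
      intro m hm hne
      exact Polynomial.X_pow_dvd_iff.mp ⟨V, hV⟩ m (by omega)
    rcases aux_step h D hD t (N - (K + 1)) ht (by omega) hh h0 hnp P
      (by rw [← eul_apply, hEP']) hbrP' with ⟨htj, c, hc⟩ | hPz
    · obtain ⟨q0, hq0⟩ := htj
      have hq0' : (N - (K + 1)) / t = q0 := by rw [hq0, Nat.mul_div_cancel_left _ (by omega)]
      have hq0lt : q0 < N / t := by
        rw [Nat.lt_div_iff_mul_lt' htN]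
        omega
      refine ⟨fun q => a q + if q = q0 then c else 0, by simp [haN, hq0lt.ne'], ?_⟩
      have : Gt - ∑ q ∈ Finset.range (N / t + 1), (a q + if q = q0 then c else 0) • Pq H U N t r q
          = W - c • Pq H U N t r q0 := by
        simp only [add_smul, Finset.sum_add_distrib, ite_smul, zero_smul, Finset.sum_ite_eq',
          Finset.mem_range]
        rw [if_pos (by omega), hW]; abel
      rw [this, Polynomial.X_pow_dvd_iff]
      intro m hm
      have hNq : N - t * q0 = K + 1 := by omega
      rw [Polynomial.coeff_sub, Polynomial.coeff_smul, Pq, hNq]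
      by_cases hmK : m = K + 1
      · subst hmK
        have h5 := Polynomial.coeff_X_pow_mul (H ^ q0 * Polynomial.aeval U (bs q0 r N)) (K+1) 0
        rw [zero_add] at h5
        rw [hWK, h5, hP0, hc, hq0', sub_self]
      · rw [hcoef m (by omega) hmK, Polynomial.coeff_X_pow_mul', if_neg (by omega)]
        simp
    · refine ⟨a, haN, ?_⟩
      rw [Polynomial.X_pow_dvd_iff]
      intro m hm
      by_cases hmK : m = K + 1
      · rw [hmK, hWK, hPz]
      · exact hcoef m (by omega) hmK

end mainind

lemma prod_Icc_mul (r k : ℕ) : ∏ m ∈ Finset.Icc 1 k, ((r : ℂ) * m) = (r : ℂ) ^ k * (k.factorial : ℂ) := by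
  rw [Finset.prod_mul_distrib, Finset.prod_const, Nat.card_Icc, Nat.add_sub_cancel]
  congr 1
  rw [← Finset.prod_range_add_one_eq_factorial, ← Finset.Ico_add_one_right_eq_Icc,
    Finset.prod_Ico_eq_prod_range]
  push_cast
  apply Finset.prod_congr rfl
  intros; ring

lemma coef_eq (q r s : ℕ) (hr : 1 ≤ r) (α : Fin s → ℕ) :
    bc q r (∑ l, α l) * (Nat.multinomial Finset.univ α : ℂ) =
      (∏ m ∈ Finset.Icc 1 (∑ l, α l), ((((q : ℤ) - r * (∑ l, α l : ℕ) : ℤ) : ℂ) + r * m)) /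
        ∏ l, ∏ i' ∈ Finset.Icc 1 (α l), ((r : ℂ) * i') := by
  have hr0 : (r : ℂ) ≠ 0 := by exact_mod_cast (by omega : r ≠ 0)
  set k := ∑ l, α l with hk
  simp only [prod_Icc_mul]
  rw [Finset.prod_mul_distrib, Finset.prod_pow_eq_pow_sum, ← hk]
  have hmul := Nat.multinomial_spec Finset.univ α
  rw [← hk] at hmul
  have hmulC : (∏ l, ((α l).factorial : ℂ)) * (Nat.multinomial Finset.univ α : ℂ) = (k.factorial : ℂ) := by
    exact_mod_cast hmul
  have hfac : (∏ l, ((α l).factorial : ℂ)) ≠ 0 :=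
    Finset.prod_ne_zero_iff.mpr fun l _ => by exact_mod_cast Nat.factorial_ne_zero _
  have hden : ∏ m ∈ Finset.range k, ((r : ℂ) * (m + 1)) = (r : ℂ) ^ k * (k.factorial : ℂ) := by
    rw [Finset.prod_mul_distrib, Finset.prod_const, Finset.card_range,
      ← Finset.prod_range_add_one_eq_factorial]
    push_cast
    rfl
  have hnum : ∏ m ∈ Finset.Icc 1 k, ((((q : ℤ) - r * (k : ℕ) : ℤ) : ℂ) + r * m) =
      ∏ m ∈ Finset.range k, ((q : ℂ) - r * m) := by
    rw [← Finset.prod_range_reflect, Finset.range_eq_Ico, Finset.prod_Ico_eq_prod_range,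
      ← Finset.Ico_add_one_right_eq_Icc, Finset.prod_Ico_eq_prod_range]
    simp only [Nat.add_sub_cancel, Nat.sub_zero]
    apply Finset.prod_congr rfl
    intro m hm
    have hm' : m < k := Finset.mem_range.mp hm
    have : ((k - 1 - (0 + m) : ℕ) : ℂ) = k - 1 - m := by
      rw [zero_add, Nat.cast_sub (by omega), Nat.cast_sub (by omega)]; simp
    rw [this]
    push_cast
    ring
  rw [hnum, bc, Finset.prod_div_distrib, hden, ← hmulC]
  have hmn : (Nat.multinomial Finset.univ α : ℂ) ≠ 0 := by
    exact_mod_cast (Nat.multinomial_pos _ _).ne'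
  field_simp

lemma coeff_Pq {n : ℕ} (h : MvPolynomial (Fin n) ℂ) (s N t r q e : ℕ)
    (Fl : Fin s → MvPolynomial (Fin n) ℂ) (U : Polynomial (Localization.Away h))
    (hU : U = ∑ l : Fin s, Polynomial.C (algebraMap _ (Localization.Away h) (Fl l) *
      (((hUnit h)⁻¹ : (Localization.Away h)ˣ) : Localization.Away h) ^ r) * Polynomial.X ^ (s - (l : ℕ))) :
    (Pq (Polynomial.C (algebraMap _ (Localization.Away h) h)) U N t r q).coeff e =
      ∑ k ∈ Finset.range (N + 1), ∑ α ∈ Finset.piAntidiag Finset.univ k,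
        if e = N - t * q + ∑ l : Fin s, (s - (l : ℕ)) * α l then
          (bc q r k * (Nat.multinomial Finset.univ α : ℂ)) •
            monom h s Fl ((q : ℤ) - r * (k : ℕ), α) else 0 := by
  have hterm : ∀ k, ∀ α ∈ Finset.piAntidiag (Finset.univ : Finset (Fin s)) k,
      ∏ l : Fin s, (Polynomial.C (algebraMap _ (Localization.Away h) (Fl l) *
      (((hUnit h)⁻¹ : (Localization.Away h)ˣ) : Localization.Away h) ^ r) *
        Polynomial.X ^ (s - (l : ℕ))) ^ α l =
      Polynomial.C ((∏ l, algebraMap _ (Localization.Away h) (Fl l) ^ α l) *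
        (((hUnit h)⁻¹ : (Localization.Away h)ˣ) : Localization.Away h) ^ (r * k)) *
          Polynomial.X ^ (∑ l : Fin s, (s - (l : ℕ)) * α l) := by
    intro k α hα
    have hk : ∑ l, α l = k := (Finset.mem_piAntidiag.mp hα).1
    simp only [mul_pow, Finset.prod_mul_distrib, ← map_pow, ← map_prod, ← pow_mul,
      Finset.prod_pow_eq_pow_sum, ← Finset.mul_sum, hk, map_mul]
  have hmon : ∀ k (α : Fin s → ℕ), monom h s Fl ((q : ℤ) - r * (k : ℕ), α) =
      algebraMap _ (Localization.Away h) h ^ q * ((∏ l, algebraMap _ (Localization.Away h) (Fl l) ^ α l) *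
        (((hUnit h)⁻¹ : (Localization.Away h)ˣ) : Localization.Away h) ^ (r * k)) := by
    intro k α
    have hu : ((hUnit h : (Localization.Away h)ˣ) : Localization.Away h) =
      algebraMap _ (Localization.Away h) h := rfl
    rw [monom, ← hu, ← Units.val_pow_eq_pow_val, ← Units.val_pow_eq_pow_val]
    have : (hUnit h) ^ ((q : ℤ) - r * (k : ℕ)) = (hUnit h) ^ q * ((hUnit h)⁻¹) ^ (r * k) := by
      rw [zpow_sub, zpow_natCast, inv_pow]
      congr 2
    rw [this, Units.val_mul]
    ring
  have hexp : Pq (Polynomial.C (algebraMap _ (Localization.Away h) h)) U N t r q =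
      ∑ k ∈ Finset.range (N + 1), ∑ α ∈ Finset.piAntidiag Finset.univ k,
        Polynomial.C ((bc q r k * (Nat.multinomial Finset.univ α : ℂ)) •
            monom h s Fl ((q : ℤ) - r * (k : ℕ), α)) *
          Polynomial.X ^ (N - t * q + ∑ l : Fin s, (s - (l : ℕ)) * α l) := by
    rw [Pq, bs, map_sum, Finset.mul_sum, Finset.mul_sum]
    apply Finset.sum_congr rfl
    intro k _
    rw [map_mul, map_pow, Polynomial.aeval_C, Polynomial.aeval_X, hU,
      Finset.sum_pow_eq_sum_piAntidiag, Finset.mul_sum, Finset.mul_sum, Finset.mul_sum]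
    apply Finset.sum_congr rfl
    intro α hα
    rw [hterm k α hα, hmon, Algebra.smul_def, Polynomial.algebraMap_apply, pow_add]
    simp only [map_mul, map_natCast, map_pow]
    ring
  rw [hexp]
  simp only [Polynomial.finsetSum_coeff, Polynomial.coeff_C_mul_X_pow]

lemma final_sum {n : ℕ} (h : MvPolynomial (Fin n) ℂ) (s d N t r j : ℕ) (hr : 1 ≤ r) (ht : 1 ≤ t)
    (hd : d = s + 1) (hdt : d = t * r) (hj : 1 ≤ j) (hjN : j ≤ N)
    (Fl : Fin s → MvPolynomial (Fin n) ℂ) (U : Polynomial (Localization.Away h))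
    (hU : U = ∑ l : Fin s, Polynomial.C (algebraMap _ (Localization.Away h) (Fl l) *
      (((hUnit h)⁻¹ : (Localization.Away h)ˣ) : Localization.Away h) ^ r) * Polynomial.X ^ (s - (l : ℕ)))
    (a' : ℕ → ℂ) (a : ℤ → ℂ) (ha : ∀ q : ℕ, a (t * q) = a' q) :
    (∑ q ∈ Finset.range (N / t + 1), a' q •
      Pq (Polynomial.C (algebraMap _ (Localization.Away h) h)) U N t r q).coeff (N - j) =
    ∑ᶠ α ∈ ZsetT s j N d t,
            (((∏ m ∈ Finset.Icc 1 (∑ l : Fin s, α.2 l), ((α.1 : ℂ) + r * m)) /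
                ∏ l : Fin s, ∏ i' ∈ Finset.Icc 1 (α.2 l), ((r : ℂ) * i')) *
              a (t * α.1 + d * ∑ l : Fin s, (α.2 l : ℤ))) •
            monom h s Fl α := by
  classical
  set f : ℤ × (Fin s → ℕ) → Localization.Away h := fun α =>
    (((∏ m ∈ Finset.Icc 1 (∑ l : Fin s, α.2 l), ((α.1 : ℂ) + r * m)) /
                ∏ l : Fin s, ∏ i' ∈ Finset.Icc 1 (α.2 l), ((r : ℂ) * i')) *
              a (t * α.1 + d * ∑ l : Fin s, (α.2 l : ℤ))) •
            monom h s Fl α with hf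
  let V : Finset (Fin s → ℕ) := (Finset.range (N + 1)).biUnion
    (fun k => Finset.piAntidiag Finset.univ k)
  have hV : ∀ α, α ∈ V ↔ ∑ l, α l ≤ N := by
    intro α
    simp [V]
  let c : ℕ × (Fin s → ℕ) → Prop := fun x =>
    N - j = N - t * x.1 + ∑ l : Fin s, (s - (l : ℕ)) * x.2 l
  let J := ((Finset.range (N / t + 1)) ×ˢ V).filter c
  let g : ℕ × (Fin s → ℕ) → ℤ × (Fin s → ℕ) := fun x => ((x.1 : ℤ) - r * (∑ l, x.2 l : ℕ), x.2)
  have hg : Function.Injective g := by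
    rintro ⟨q1, α1⟩ ⟨q2, α2⟩ h
    simp only [g, Prod.mk.injEq] at h
    obtain ⟨h1, rfl⟩ := h
    have : (q1 : ℤ) = q2 := by linarith
    simp; exact_mod_cast this
  have hsum : ∀ α : Fin s → ℕ, (∑ l : Fin s, (((s - (l : ℕ)) * α l : ℕ) : ℤ)) =
      d * ∑ l, (α l : ℤ) - ∑ l : Fin s, ((l : ℤ) + 1) * (α l : ℤ) := by
    intro α
    rw [Finset.mul_sum, ← Finset.sum_sub_distrib]
    apply Finset.sum_congr rfl
    intro l _
    rw [hd, Nat.cast_mul, Nat.cast_sub l.2.le]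
    push_cast; ring
  have hle : ∀ α : Fin s → ℕ, ∑ l, α l ≤ ∑ l : Fin s, (s - (l : ℕ)) * α l := by
    intro α
    apply Finset.sum_le_sum
    intro l _
    have : 1 ≤ s - (l : ℕ) := by have := l.2; omega
    nlinarith
  have hdt' : (d : ℤ) = t * r := by exact_mod_cast hdt
  have hZ : ZsetT s j N d t = ((J.image g : Finset _) : Set _) := by
    ext ⟨α0, α⟩
    simp only [ZsetT, Set.mem_ofPred_eq, Finset.coe_image, Set.mem_image, Finset.mem_coe, J,
      Finset.mem_filter, Finset.mem_product, Finset.mem_range, hV, c, g, Prod.mk.injEq, Prod.exists]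
    have hS := hsum α
    have hl := hle α
    constructor
    · rintro ⟨h1, h2⟩
      have e1 : (t : ℤ) * (α0 + r * ∑ l, (α l : ℤ)) = t * α0 + d * ∑ l, (α l : ℤ) := by
        rw [hdt']; ring
      have e0 : (0 : ℤ) ≤ ∑ l : Fin s, (((s - (l : ℕ)) * α l : ℕ) : ℤ) :=
        Finset.sum_nonneg fun _ _ => by positivity
      have hpos : (0 : ℤ) < t * (α0 + r * ∑ l, (α l : ℤ)) := by
        rw [e1]; have : (1 : ℤ) ≤ j := by exact_mod_cast hj
        linarith
      have hq : (0 : ℤ) ≤ α0 + r * ∑ l, (α l : ℤ) :=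
        (pos_of_mul_pos_right hpos (by positivity)).le
      obtain ⟨q, hq⟩ := Int.eq_ofNat_of_zero_le hq
      rw [hq] at e1
      have hqN : t * q ≤ N := by
        have : (t : ℤ) * q ≤ N := by rw [e1]; exact h2
        exact_mod_cast this
      have e2 : (t * q : ℕ) = j + ∑ l : Fin s, (s - (l : ℕ)) * α l := by
        have : (t : ℤ) * q = j + ∑ l : Fin s, (((s - (l : ℕ)) * α l : ℕ) : ℤ) := by
          rw [hS, e1]; linarith
        exact_mod_cast this
      refine ⟨q, α, ⟨⟨?_, ?_⟩, ?_⟩, ?_, rfl⟩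
      · rw [Nat.lt_succ_iff, Nat.le_div_iff_mul_le (by omega), mul_comm]; exact hqN
      · omega
      · omega
      · push_cast; linarith
    · rintro ⟨q, β, ⟨⟨h1, h2⟩, h3⟩, h4, rfl⟩
      have hqN : t * q ≤ N := by
        rw [Nat.lt_succ_iff, Nat.le_div_iff_mul_le (by omega), mul_comm] at h1; exact h1
      have e2 : (t * q : ℕ) = j + ∑ l : Fin s, (s - (l : ℕ)) * β l := by omega
      have e3 : (t : ℤ) * q = j + ∑ l : Fin s, (((s - (l : ℕ)) * β l : ℕ) : ℤ) := by
        exact_mod_cast e2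
      have hqN' : (t : ℤ) * q ≤ N := by exact_mod_cast hqN
      push_cast at h4
      have e4 : (t : ℤ) * α0 = t * q - d * ∑ l, (β l : ℤ) := by
        rw [← h4, hdt']; ring
      constructor
      · rw [e4]; linarith
      · rw [e4]; linarith
  rw [hZ, finsum_mem_coe_finset, Finset.sum_image (fun x _ y _ hxy => hg hxy)]
  rw [Finset.sum_filter, Finset.sum_product, Polynomial.finsetSum_coeff]
  apply Finset.sum_congr rfl
  intro q _
  rw [Polynomial.coeff_smul, coeff_Pq h s N t r q (N - j) Fl U hU, Finset.sum_biUnion]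
  · rw [Finset.smul_sum]
    apply Finset.sum_congr rfl
    intro k _
    rw [Finset.smul_sum]
    apply Finset.sum_congr rfl
    intro α hα
    have hk : ∑ l, α l = k := (Finset.mem_piAntidiag.mp hα).1
    subst hk
    split_ifs
    · simp only [g]
      rw [coef_eq q r s hr α, smul_smul, mul_comm]
      congr 2
      rw [← ha]
      congr 1
      rw [hdt']; push_cast; ring
    · simp
  · intro k1 _ k2 _ hne
    rw [Function.onFun, Finset.disjoint_left]
    intro α h1 h2
    exact hne ((Finset.mem_piAntidiag.mp h1).1.symm.trans (Finset.mem_piAntidiag.mp h2).1)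

theorem stmt_6 {n : ℕ} (F G h : MvPolynomial (Fin n) ℂ) (d N s t r : ℕ) (aN : ℂ)
    (hd : 2 ≤ d) (hdN : d ≤ N) (hs : s = d - 1)
    (hFdeg : F.totalDegree = d) (hGdeg : G.totalDegree = N)
    (hF0 : MvPolynomial.coeff 0 F = 0) (hG0 : MvPolynomial.coeff 0 G = 0)
    (ht : 1 ≤ t) (hh : h.IsHomogeneous t) (hhnp : NotProperPower h)
    (htdvd : t ∣ Nat.gcd d N) (hr : r = d / t)
    (hFd : homogeneousComponent d F = h ^ (d / t))
    (haN : aN ≠ 0) (hGN : homogeneousComponent N G = aN • h ^ (N / t))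
    (i : ℕ) (hi : 1 ≤ i) (hiN : i ≤ N)
    (hdeg : PoissonDegLT F G ((d : ℤ) + i)) :
    ∃ a : ℤ → ℂ, a N = aN ∧
      (∀ j : ℤ, ¬ (t : ℤ) ∣ j → a j = 0) ∧
      ∀ j : ℕ, i ≤ j → j ≤ N →
        algebraMap (MvPolynomial (Fin n) ℂ) (Localization.Away h)
            (homogeneousComponent j G) =
          ∑ᶠ α ∈ ZsetT s j N d t,
            (((∏ m ∈ Finset.Icc 1 (∑ l : Fin s, α.2 l), ((α.1 : ℂ) + r * m)) /
                ∏ l : Fin s, ∏ i' ∈ Finset.Icc 1 (α.2 l), ((r : ℂ) * i')) *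
              a (t * α.1 + d * ∑ l : Fin s, (α.2 l : ℤ))) •
            monom h s (fun l => homogeneousComponent ((l : ℕ) + 1) F) α := by
  classical
  have htd : t ∣ d := htdvd.trans (Nat.gcd_dvd_left d N)
  have htN : t ∣ N := htdvd.trans (Nat.gcd_dvd_right d N)
  have hdt : d = t * r := by rw [hr, Nat.mul_div_cancel' htd]
  have hr1 : 1 ≤ r := by
    rcases Nat.eq_zero_or_pos r with h | h
    · rw [h] at hdt; omega
    · exact h
  have hds : d = s + 1 := by omega
  rw [← hr] at hFd
  have h0 : h ≠ 0 := by
    rintro rfl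
    have hGz : homogeneousComponent d F ≠ 0 := by
      intro hz
      have hF0' : F ≠ 0 := by rintro rfl; simp at hFdeg; omega
      obtain ⟨m, hm, hmd⟩ := Finset.exists_mem_eq_sup F.support (by simpa using hF0')
        (fun m => m.sum fun _ e => e)
      have h1 : m.degree = d := by
        rw [← hFdeg, totalDegree, hmd]; rfl
      have h2 := congrArg (coeff m) hz
      rw [coeff_homogeneousComponent, if_pos h1] at h2
      exact (mem_support_iff.mp hm) (by simpa using h2)
    apply hGz
    rw [hFd, zero_pow (by omega)]
  choose D hD using fun p : Fin n => aux_ext (A := Localization.Away h) h (pderiv p)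
  set Ft : Polynomial (Localization.Away h) := Polynomial.reflect d (lam _ F) with hFt
  set Gt : Polynomial (Localization.Away h) := Polynomial.reflect N (lam _ G) with hGt
  set hinv : Localization.Away h := (((hUnit h)⁻¹ : (Localization.Away h)ˣ) : Localization.Away h)
    with hhinv
  have hinvmul : algebraMap _ (Localization.Away h) h * hinv = 1 := (hUnit h).mul_inv
  have hinvr : algebraMap _ (Localization.Away h) h ^ r * hinv ^ r = 1 := by
    rw [← mul_pow, hinvmul, one_pow]
  set Fl : Fin s → MvPolynomial (Fin n) ℂ := fun l => homogeneousComponent ((l : ℕ) + 1) F with hFl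
  set U : Polynomial (Localization.Away h) := ∑ l : Fin s,
    Polynomial.C (algebraMap _ (Localization.Away h) (Fl l) * hinv ^ r) *
      Polynomial.X ^ (s - (l : ℕ)) with hU
  have hFcoef : ∀ m, Ft.coeff m = if m ≤ d then
      algebraMap _ (Localization.Away h) (homogeneousComponent (d - m) F) else 0 := by
    intro m
    rw [hFt, Polynomial.coeff_reflect, coeff_lam]
    split_ifs with hm
    · rw [Polynomial.revAt_le hm]
    · rw [Polynomial.revAt_eq_self_of_lt (by omega), homogeneousComponent_eq_zero _ _ (by omega),
        map_zero]
  have hUcoef : ∀ m, U.coeff m = ∑ l : Fin s, if m = s - (l : ℕ) then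
      algebraMap _ (Localization.Away h) (Fl l) * hinv ^ r else 0 := by
    intro m
    rw [hU, Polynomial.finsetSum_coeff]
    simp only [Polynomial.coeff_C_mul_X_pow]
  have hUX : Polynomial.X ∣ U := by
    rw [hU]
    apply Finset.dvd_sum
    intro l _
    exact (dvd_pow_self _ (by have := l.2; omega)).mul_left _
  have hFU : Ft = Polynomial.C (algebraMap _ (Localization.Away h) h) ^ r * (1 + U) := by
    ext m
    rw [hFcoef, ← map_pow, Polynomial.coeff_C_mul, Polynomial.coeff_add, hUcoef,
      Polynomial.coeff_one]
    by_cases hm0 : m = 0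
    · subst hm0
      rw [Finset.sum_eq_zero (fun l _ => if_neg (by have := l.2; omega))]
      simp [hFd]
    rw [if_neg hm0, zero_add]
    by_cases hms : m ≤ s
    · rw [if_pos (by omega), Finset.sum_eq_single (⟨s - m, by omega⟩ : Fin s)]
      · rw [if_pos (by simp; omega)]
        have : Fl ⟨s - m, by omega⟩ = homogeneousComponent (d - m) F := by
          simp only [hFl]; congr 1; congr 1; omega
        rw [this]
        linear_combination (- algebraMap _ (Localization.Away h) (homogeneousComponent (d - m) F)) * hinvr
      · intro l _ hl
        rw [if_neg]
        intro h'
        apply hl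
        ext
        simp only
        have := l.2
        omega
      · simp
    · rw [Finset.sum_eq_zero (fun l _ => if_neg (by have := l.2; omega)), mul_zero]
      split_ifs with hmd
      · have : d - m = 0 := by omega
        rw [this, homogeneousComponent_zero, hF0, map_zero, map_zero]
      · rfl
  have hGcoef : ∀ m ≤ N, Gt.coeff m =
      algebraMap _ (Localization.Away h) (homogeneousComponent (N - m) G) := by
    intro m hm
    rw [hGt, Polynomial.coeff_reflect, coeff_lam, Polynomial.revAt_le hm]
  obtain ⟨a', ha'N, ha'⟩ := main_ind h D hD t N r i ht hr1 hi hiN htN hh h0 hhnp Ft Gt U _ rfl hFU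
    hUX (by rw [hFt, eulT_reflect D hD F d hFdeg, hdt, mul_comm t r])
    (eulT_reflect D hD G N hGdeg) aN
    (by
      rw [hGcoef 0 (by omega), Nat.sub_zero, hGN, MvPolynomial.smul_eq_C_mul, Algebra.smul_def, map_mul,
        map_pow, IsScalarTower.algebraMap_apply ℂ (MvPolynomial (Fin n) ℂ) (Localization.Away h)]
      rfl)
    (fun p q => bracket_reflect D hD F G d N i hFdeg hGdeg hiN p q (hdeg p q)) (N - i) le_rfl
  let a : ℤ → ℂ := fun z => if (t : ℤ) ∣ z then a' (z / t).toNat else 0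
  have hta : ∀ q : ℕ, a (t * q) = a' q := by
    intro q
    have htz : (t : ℤ) ≠ 0 := by exact_mod_cast (by omega : t ≠ 0)
    simp only [a]
    rw [if_pos (dvd_mul_right _ _), Int.mul_ediv_cancel_left _ htz]
    rfl
  refine ⟨a, ?_, ?_, ?_⟩
  · rw [← ha'N, ← hta]
    congr 1
    exact_mod_cast (Nat.mul_div_cancel' htN).symm
  · intro j hj
    simp only [a]
    rw [if_neg hj]
  · intro j hij hjN
    rw [← final_sum h s d N t r j hr1 ht hds hdt (by omega) hjN Fl U hU a' a hta]
    have h1 := Polynomial.X_pow_dvd_iff.mp ha' (N - j) (by omega)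
    rw [Polynomial.coeff_sub, sub_eq_zero, hGcoef _ (by omega)] at h1
    rw [← h1]
    congr 2
    congr 1
    omega
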